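/- Let d, m, L, T be positive integers with m ≥ 1, L ≥ 1, and suppose both L and m+L divide T; let n = T/(m+L). Let 𝒜 ⊆ ℝ^d, let 𝒜₀ = 𝒜 ∪ {0_d}, and let f : 𝒜₀^m × 𝒜₀ → ℝ satisfy |f(h, a)| ≤ R for all h ∈ 𝒜₀^m, a ∈ 𝒜₀, for some R ≥ 0. Let OPT be the supremum over sequences in 𝒜₀^T (zero-padded for t ≤ 0) of the total reward, and suppose ã ∈ 𝒜₀^{m+L} attains the supremum of the proxy reward r̃ over 𝒜₀^{m+L}. Let a^{(1)},…,a^{(n)} ∈ 𝒜₀^{m+L} be arbitrary blocks and let (r_t)_{t=1}^T be the instantaneous rewards of the concatenated sequence a^{(1)} a^{(2)} ⋯ a^{(n)} (zero-padded for t ≤ 0). If Σ_{τ=1}^n ( r̃(ã) − r̃(a^{(τ)}) ) ≤ E for some E ≥ 0, then OPT − Σ_{t=1}^T r_t ≤ E + 4mRT/(m+L). -/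

import Mathlib

open Finset

/-- Instantaneous reward at time `t` of the (zero-padded, `ℤ`-indexed) sequence `a`,
under the reward function `f` with memory size `m`. -/
noncomputable def instReward {V : Type*} (m : ℕ) (f : (Fin m → V) → V → ℝ)
    (a : ℤ → V) (t : ℤ) : ℝ :=
  f (fun s => a (t - (m : ℤ) + (s.1 : ℤ))) (a t)

/-- Total reward of the sequence `a` over the horizon `t = 1, …, T`. -/
noncomputable def totalReward {V : Type*} (m : ℕ) (f : (Fin m → V) → V → ℝ)
    (T : ℕ) (a : ℤ → V) : ℝ :=
  ∑ t ∈ Finset.Icc (1 : ℤ) (T : ℤ), instReward m f a t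

/-- Proxy reward of a block `b` (indexed by `1, …, m+L`). -/
noncomputable def proxyReward {V : Type*} (m L : ℕ) (f : (Fin m → V) → V → ℝ)
    (b : ℕ → V) : ℝ :=
  ∑ i ∈ Finset.Icc (m + 1) (m + L), f (fun s => b (i - m + (s.1 : ℕ))) (b i)

/-- The `ℤ`-indexed sequence obtained by concatenating the blocks
`blocks 1, blocks 2, …` (each of length `p`), zero-padded for `t ≤ 0`. -/
noncomputable def concatBlocks {V : Type*} [Zero V] (p : ℕ) (blocks : ℕ → ℕ → V)
    (t : ℤ) : V :=
  if t ≤ 0 then 0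
  else blocks (((t - 1) / (p : ℤ)).toNat + 1) (((t - 1) % (p : ℤ)).toNat + 1)

/-- The set of achievable total rewards over horizon `T`, for zero-padded sequences
taking values in `A0` on `{1, …, T}`.  Its supremum is `OPT`. -/
noncomputable def rewardSet {V : Type*} [Zero V] (m : ℕ) (f : (Fin m → V) → V → ℝ)
    (A0 : Set V) (T : ℕ) : Set ℝ :=
  {x | ∃ a : ℤ → V, (∀ t : ℤ, t ≤ 0 → a t = 0) ∧
    (∀ t : ℤ, 1 ≤ t → t ≤ (T : ℤ) → a t ∈ A0) ∧ x = totalReward m f T a}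

theorem totalReward_eq_sum_range {V : Type*} (m : ℕ) (f : (Fin m → V) → V → ℝ) (T : ℕ)
    (a : ℤ → V) :
    totalReward m f T a = ∑ t ∈ Finset.range T, instReward m f a ((t : ℤ) + 1) := by
  unfold totalReward
  symm
  refine Finset.sum_bij' (fun t _ => (t : ℤ) + 1) (fun t _ => (t - 1).toNat) ?_ ?_ ?_ ?_ ?_
  · intro t ht
    simp only [Finset.mem_range] at ht
    simp only [Finset.mem_Icc]
    omega
  · intro t ht
    simp only [Finset.mem_Icc] at ht
    simp only [Finset.mem_range]
    omega
  · intro t _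
    simp
  · intro t ht
    simp only [Finset.mem_Icc] at ht
    omega
  · intro t _
    rfl

theorem proxyReward_congr {V : Type*} {m L : ℕ} (f : (Fin m → V) → V → ℝ) {b b' : ℕ → V}
    (h : ∀ i ∈ Finset.Icc 1 (m + L), b i = b' i) :
    proxyReward m L f b = proxyReward m L f b' := by
  unfold proxyReward
  refine Finset.sum_congr rfl fun i hi => ?_
  rw [Finset.mem_Icc] at hi
  rw [h i (Finset.mem_Icc.2 (by omega))]
  congr 1
  funext s
  exact h _ (Finset.mem_Icc.2 (by omega))

/-- The proxy reward of the block of `a` starting after time `c` is the sum of the last `L`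
instantaneous rewards of that block. -/
theorem proxyReward_shift {V : Type*} (m L : ℕ) (f : (Fin m → V) → V → ℝ) (a : ℤ → V) (c : ℕ) :
    proxyReward m L f (fun i => a ((c : ℤ) + i)) =
      ∑ j ∈ Finset.range L, instReward m f a (((c + m + j : ℕ) : ℤ) + 1) := by
  unfold proxyReward
  symm
  refine Finset.sum_bij' (fun j _ => m + 1 + j) (fun i _ => i - (m + 1)) ?_ ?_ ?_ ?_ ?_
  · intro j hj
    simp only [Finset.mem_range] at hj
    simp only [Finset.mem_Icc]
    omega
  · intro i hi
    simp only [Finset.mem_Icc] at hi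
    simp only [Finset.mem_range]
    omega
  · intro j _
    omega
  · intro i hi
    simp only [Finset.mem_Icc] at hi
    omega
  · intro j _
    unfold instReward
    congr 1
    · funext s
      congr 1
      omega
    · congr 1
      push_cast
      ring

/-- Splitting the horizon into `n` blocks of length `m + L`, the total reward differs from the sum
of the proxy rewards of the blocks by at most `m * R` per block. -/
theorem abs_totalReward_sub_sum_proxyReward_le {V : Type*} (m L : ℕ) (f : (Fin m → V) → V → ℝ)
    (R : ℝ) (a : ℤ → V) (n : ℕ)
    (ha : ∀ t : ℤ, t ≤ ((n * (m + L) : ℕ) : ℤ) → |instReward m f a t| ≤ R) :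
    |totalReward m f (n * (m + L)) a -
      ∑ k ∈ Finset.range n, proxyReward m L f (fun i => a (((k * (m + L) : ℕ) : ℤ) + i))| ≤
      n * (m * R) := by
  rw [totalReward_eq_sum_range]
  induction n with
  | zero => simp
  | succ n ih =>
    have hle : n * (m + L) + m + L = (n + 1) * (m + L) := by ring
    have ih := ih fun t ht => ha t (by rw [← hle]; push_cast at ht ⊢; linarith)
    have hfirst : |∑ j ∈ Finset.range m,
        instReward m f a (((n * (m + L) + j : ℕ) : ℤ) + 1)| ≤ m * R := by
      calc _ ≤ ∑ j ∈ Finset.range m,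
            |instReward m f a (((n * (m + L) + j : ℕ) : ℤ) + 1)| :=
            Finset.abs_sum_le_sum_abs _ _
        _ ≤ ∑ _j ∈ Finset.range m, R := by
            refine Finset.sum_le_sum fun j hj => ha _ ?_
            rw [Finset.mem_range] at hj
            rw [← hle]
            push_cast
            linarith [(by exact_mod_cast hj : (j : ℤ) + 1 ≤ m)]
        _ = m * R := by simp
    rw [← hle, Finset.sum_range_add, Finset.sum_range_add, Finset.sum_range_succ _ n,
      proxyReward_shift]
    rw [abs_le] at *
    push_cast at *
    constructor <;> linarith

theorem concatBlocks_add {V : Type*} [Zero V] (p : ℕ) (blocks : ℕ → ℕ → V) (k i : ℕ)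
    (hi : i ∈ Finset.Icc 1 p) :
    concatBlocks p blocks (((k * p : ℕ) : ℤ) + i) = blocks (k + 1) i := by
  rw [Finset.mem_Icc] at hi
  obtain ⟨j, rfl⟩ := Nat.exists_eq_add_of_le' hi.1
  have hpos : ¬ (((k * p : ℕ) : ℤ) + ((j + 1 : ℕ) : ℤ) ≤ 0) := by omega
  have hsub : ((k * p : ℕ) : ℤ) + ((j + 1 : ℕ) : ℤ) - 1 = ((j + p * k : ℕ) : ℤ) := by
    push_cast
    ring
  have hj : j < p := by omega
  rw [concatBlocks, if_neg hpos, hsub, ← Int.natCast_div, ← Int.natCast_mod, Int.toNat_natCast,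
    Int.toNat_natCast, Nat.add_mul_div_left _ _ (by omega), Nat.add_mul_mod_self_left,
    Nat.div_eq_of_lt hj, Nat.mod_eq_of_lt hj, Nat.zero_add]

theorem concatBlocks_mem {V : Type*} [Zero V] {p n : ℕ} {blocks : ℕ → ℕ → V} {A : Set V}
    (h0 : (0 : V) ∈ A)
    (hblocks : ∀ τ ∈ Finset.Icc 1 n, ∀ i ∈ Finset.Icc 1 p, blocks τ i ∈ A) (t : ℤ)
    (ht : t ≤ ((n * p : ℕ) : ℤ)) : concatBlocks p blocks t ∈ A := by
  unfold concatBlocks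
  split_ifs with h
  · exact h0
  · obtain ⟨u, hu⟩ := Int.eq_ofNat_of_zero_le (show 0 ≤ t - 1 by omega)
    have hlt : u < n * p := by omega
    have hp : 0 < p := Nat.pos_of_mul_pos_left (by omega : 0 < n * p)
    rw [hu, ← Int.natCast_div, ← Int.natCast_mod, Int.toNat_natCast, Int.toNat_natCast]
    have h1 : u / p < n := Nat.div_lt_of_lt_mul (by rwa [mul_comm])
    have h2 : u % p < p := Nat.mod_lt _ hp
    exact hblocks _ (Finset.mem_Icc.2 ⟨Nat.succ_pos _, h1⟩) _ (Finset.mem_Icc.2 ⟨Nat.succ_pos _, h2⟩)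

/-- composition step: a bound `E` on the block regret against the
best block `ã` yields a bound `E + 4mRT/(m+L)` on the true regret of the concatenated
sequence against the optimal sequence of actions. -/
theorem stmt_7 (d m L T : ℕ) (hd : 0 < d) (hm : 1 ≤ m) (hL : 1 ≤ L) (hT : 0 < T)
    (hLdvd : L ∣ T) (hmLdvd : (m + L) ∣ T) (n : ℕ) (hn : n = T / (m + L))
    (𝒜 : Set (Fin d → ℝ)) (A0 : Set (Fin d → ℝ)) (hA0 : A0 = 𝒜 ∪ {0})
    (f : (Fin m → (Fin d → ℝ)) → (Fin d → ℝ) → ℝ) (R : ℝ) (hR : 0 ≤ R)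
    (hf : ∀ (h : Fin m → (Fin d → ℝ)) (a : Fin d → ℝ),
      (∀ s, h s ∈ A0) → a ∈ A0 → |f h a| ≤ R)
    (atil : ℕ → (Fin d → ℝ))
    (hatil_mem : ∀ i ∈ Finset.Icc 1 (m + L), atil i ∈ A0)
    (hatil_opt : ∀ b : ℕ → (Fin d → ℝ),
      (∀ i ∈ Finset.Icc 1 (m + L), b i ∈ A0) →
      proxyReward m L f b ≤ proxyReward m L f atil)
    (blocks : ℕ → ℕ → (Fin d → ℝ))
    (hblocks : ∀ τ ∈ Finset.Icc 1 n, ∀ i ∈ Finset.Icc 1 (m + L), blocks τ i ∈ A0)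
    (E : ℝ) (hE0 : 0 ≤ E)
    (hE : ∑ τ ∈ Finset.Icc 1 n,
      (proxyReward m L f atil - proxyReward m L f (blocks τ)) ≤ E) :
    sSup (rewardSet m f A0 T) - totalReward m f T (concatBlocks (m + L) blocks) ≤
      E + 4 * (m : ℝ) * R * (T : ℝ) / ((m : ℝ) + (L : ℝ)) := by
  have h0 : (0 : Fin d → ℝ) ∈ A0 := by simp [hA0]
  have hTn : T = n * (m + L) := by rw [hn, Nat.div_mul_cancel hmLdvd]
  have hbound : ∀ a : ℤ → (Fin d → ℝ), (∀ t : ℤ, t ≤ ((n * (m + L) : ℕ) : ℤ) → a t ∈ A0) →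
      ∀ t : ℤ, t ≤ ((n * (m + L) : ℕ) : ℤ) → |instReward m f a t| ≤ R := fun a ha t ht =>
    hf _ _ (fun s => ha _ (by omega)) (ha t ht)
  have hopt : sSup (rewardSet m f A0 T) ≤ n * proxyReward m L f atil + n * (m * R) := by
    refine csSup_le ⟨_, fun _ => 0, fun _ _ => rfl, fun _ _ _ => h0, rfl⟩ ?_
    rintro x ⟨a, ha0, ha, rfl⟩
    have ha' : ∀ t : ℤ, t ≤ ((n * (m + L) : ℕ) : ℤ) → a t ∈ A0 := by
      intro t ht
      rcases le_or_gt t 0 with h | h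
      · rw [ha0 t h]
        exact h0
      · exact ha t h (by rwa [hTn])
    have hdiff := abs_totalReward_sub_sum_proxyReward_le m L f R a n (hbound a ha')
    have hsum : ∑ k ∈ Finset.range n,
        proxyReward m L f (fun i => a (((k * (m + L) : ℕ) : ℤ) + i)) ≤
        n * proxyReward m L f atil := by
      calc _ ≤ ∑ _k ∈ Finset.range n, proxyReward m L f atil := by
            refine Finset.sum_le_sum fun k hk => hatil_opt _ fun i hi => ha' _ ?_
            rw [Finset.mem_range] at hk
            rw [Finset.mem_Icc] at hi
            have := Nat.mul_le_mul_right (m + L) (Nat.succ_le_of_lt hk)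
            rw [Nat.succ_mul] at this
            exact_mod_cast (by omega : k * (m + L) + i ≤ n * (m + L))
        _ = n * proxyReward m L f atil := by simp
    rw [hTn]
    linarith [(abs_le.1 hdiff).2]
  have hconcat := abs_totalReward_sub_sum_proxyReward_le m L f R
    (concatBlocks (m + L) blocks) n (hbound _ (concatBlocks_mem h0 hblocks))
  have hproxy : ∑ k ∈ Finset.range n, proxyReward m L f
      (fun i => concatBlocks (m + L) blocks (((k * (m + L) : ℕ) : ℤ) + i)) =
      ∑ τ ∈ Finset.Icc 1 n, proxyReward m L f (blocks τ) := by
    rw [← Finset.Ico_add_one_right_eq_Icc, Finset.sum_Ico_eq_sum_range, Nat.add_sub_cancel]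
    refine Finset.sum_congr rfl fun k _ => proxyReward_congr f fun i hi => ?_
    rw [concatBlocks_add _ _ _ _ hi, add_comm 1 k]
  rw [hproxy, ← hTn] at hconcat
  rw [Finset.sum_sub_distrib, Finset.sum_const, Nat.card_Icc, Nat.add_sub_cancel,
    nsmul_eq_mul] at hE
  have hpos : (0 : ℝ) < (m : ℝ) + L := by positivity
  have hrate : 4 * (m : ℝ) * R * (T : ℝ) / ((m : ℝ) + (L : ℝ)) = 4 * (n * (m * R)) := by
    rw [div_eq_iff hpos.ne', hTn]
    push_cast
    ring
  have hnonneg : 0 ≤ (n : ℝ) * (m * R) := by positivity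
  rw [hrate]
  linarith [(abs_le.1 hconcat).1]
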